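/- For a finitely supported function n : ℕ → ℕ with n(0) = 0, define Δ_n : (Set.Ioo (0:ℝ) 1) × ℝ → ℝ by Δ_n(θ, y) = ∏_{w} ((θ^w + y)/(θ^w − 1))^{n(w)}. Then there is no ℝ-linear map L from the ℝ-linear span (inside the vector space of real-valued functions on (Set.Ioo (0:ℝ) 1) × ℝ) of the set {Δ_n : n finitely supported, n(0) = 0} to the polynomial ring ℝ[Y] such that L(Δ_n) = (−Y)^{∑_{w, 2 ∣ w} n(w)} for every such n. -/

import Mathlib

open Polynomial

/-- The function `Δ_n(θ, y) = ∏_w ((θ^w + y)/(θ^w − 1))^{n(w)}` on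
`(0,1) × ℝ`, for a finitely supported multiplicity function `n : ℕ →₀ ℕ`. -/
noncomputable def Delta (n : ℕ →₀ ℕ) : (Set.Ioo (0 : ℝ) 1) × ℝ → ℝ :=
  fun p => ∏ w ∈ n.support,
    (((p.1 : ℝ) ^ w + p.2) / ((p.1 : ℝ) ^ w - 1)) ^ n w

lemma Delta_single_add_single (i j : ℕ) (p : (Set.Ioo (0 : ℝ) 1) × ℝ) :
    Delta (Finsupp.single i 1 + Finsupp.single j 1) p =
      (((p.1 : ℝ) ^ i + p.2) / ((p.1 : ℝ) ^ i - 1)) *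
        (((p.1 : ℝ) ^ j + p.2) / ((p.1 : ℝ) ^ j - 1)) := by
  change (Finsupp.single i 1 + Finsupp.single j 1).prod
    (fun w k => (((p.1 : ℝ) ^ w + p.2) / ((p.1 : ℝ) ^ w - 1)) ^ k) = _
  rw [Finsupp.prod_add_index' (fun _ => pow_zero _) (fun _ _ _ => pow_add _ _ _)]
  simp

lemma sum_even_single_add_single (i j : ℕ) :
    ∑ w ∈ (Finsupp.single i 1 + Finsupp.single j 1 : ℕ →₀ ℕ).support.filter (fun w => 2 ∣ w),
        (Finsupp.single i 1 + Finsupp.single j 1 : ℕ →₀ ℕ) w =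
      (if 2 ∣ i then 1 else 0) + (if 2 ∣ j then 1 else 0) := by
  rw [Finset.sum_filter]
  change (Finsupp.single i 1 + Finsupp.single j 1 : ℕ →₀ ℕ).sum
    (fun w k => if 2 ∣ w then k else 0) = _
  rw [Finsupp.sum_add_index' (fun _ => by simp) (fun _ _ _ => by split_ifs <;> simp)]
  simp

lemma Delta_linear_relation :
    Delta (Finsupp.single 1 1 + Finsupp.single 4 1)
      - Delta (Finsupp.single 1 1 + Finsupp.single 3 1)
      + Delta (Finsupp.single 2 1 + Finsupp.single 2 1)
      + Delta (Finsupp.single 3 1 + Finsupp.single 4 1)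
      - (2 : ℝ) • Delta (Finsupp.single 2 1 + Finsupp.single 4 1) = 0 := by
  funext p
  simp only [Pi.add_apply, Pi.sub_apply, Pi.smul_apply, Pi.zero_apply, smul_eq_mul,
    Delta_single_add_single]
  obtain ⟨⟨t, h0, h1⟩, y⟩ := p
  have hpow (k : ℕ) (hk : k ≠ 0) : t ^ k - 1 ≠ 0 :=
    (sub_neg.2 (pow_lt_one₀ h0.le h1 hk)).ne
  have ht1 : t - 1 ≠ 0 := (sub_neg.2 h1).ne
  have ht2 := hpow 2 (by norm_num)
  have ht3 := hpow 3 (by norm_num)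
  have ht4 := hpow 4 (by norm_num)
  simp only [pow_one]
  field_simp
  ring

/-- Remark 3 (kontr): there is no `ℝ`-linear map `L` from the linear span of
the functions `Δ_n` (for finitely supported `n` with `n 0 = 0`) to `ℝ[Y]`
sending each `Δ_n` to `(−Y)^{∑_{w, 2 ∣ w} n(w)}`. -/
theorem stmt15 :
    ¬ ∃ L : ↥(Submodule.span ℝ
        {f : (Set.Ioo (0 : ℝ) 1) × ℝ → ℝ |
          ∃ n : ℕ →₀ ℕ, n 0 = 0 ∧ f = Delta n}) →ₗ[ℝ] Polynomial ℝ,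
      ∀ (n : ℕ →₀ ℕ) (hn : n 0 = 0)
        (hmem : Delta n ∈ Submodule.span ℝ
          {f : (Set.Ioo (0 : ℝ) 1) × ℝ → ℝ |
            ∃ n : ℕ →₀ ℕ, n 0 = 0 ∧ f = Delta n}),
        L ⟨Delta n, hmem⟩ =
          (-(X : Polynomial ℝ)) ^ (∑ w ∈ n.support.filter (fun w => 2 ∣ w), n w) := by
  rintro ⟨L, hL⟩
  have hmem (i j : ℕ) (hi : i ≠ 0) (hj : j ≠ 0) :
      Delta (Finsupp.single i 1 + Finsupp.single j 1) ∈ Submodule.span ℝ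
        {f : (Set.Ioo (0 : ℝ) 1) × ℝ → ℝ | ∃ n : ℕ →₀ ℕ, n 0 = 0 ∧ f = Delta n} :=
    Submodule.subset_span ⟨_, by simp [hi, hj], rfl⟩
  have hval (i j : ℕ) (hi : i ≠ 0) (hj : j ≠ 0) :
      L ⟨_, hmem i j hi hj⟩ =
        (-(X : ℝ[X])) ^ ((if 2 ∣ i then 1 else 0) + (if 2 ∣ j then 1 else 0)) := by
    rw [hL _ (by simp [hi, hj]), sum_even_single_add_single]
  have hrel : (⟨_, hmem 1 4 (by simp) (by simp)⟩ : Submodule.span ℝ _)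
      - ⟨_, hmem 1 3 (by simp) (by simp)⟩ + ⟨_, hmem 2 2 (by simp) (by simp)⟩
      + ⟨_, hmem 3 4 (by simp) (by simp)⟩
      - (2 : ℝ) • ⟨_, hmem 2 4 (by simp) (by simp)⟩ = 0 :=
    Subtype.ext Delta_linear_relation
  have himage := congrArg (fun f => (L f).eval 0) hrel
  simp only [map_add, map_sub, map_smul, map_zero, hval _ _ one_ne_zero four_ne_zero,
    hval _ _ one_ne_zero three_ne_zero, hval _ _ two_ne_zero two_ne_zero,
    hval _ _ three_ne_zero four_ne_zero, hval _ _ two_ne_zero four_ne_zero] at himage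
  norm_num at himage
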